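/- Let z ≠ 0 be real and, on the open subset of ℝ² where q_1 ≠ 0 and q_2 ≠ 0, consider the diagonal metric with g_{11}(q_1,q_2) = (2 z q_1²/sinh(z q_1²)) e^{−z q_2²} and g_{22}(q_1,q_2) = (2 z q_2²/sinh(z q_2²)) e^{z q_1²}. Then its Gaussian curvature equals K(q_1,q_2) = −z · sinh( z (q_1² + q_2²) ) at every point of this open set. -/

import Mathlib

open Real

noncomputable section

/-- Partial derivative in the first coordinate of a function on ℝ². -/
noncomputable def pd1 (f : ℝ × ℝ → ℝ) (x : ℝ × ℝ) : ℝ :=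
  deriv (fun t => f (t, x.2)) x.1

/-- Partial derivative in the second coordinate of a function on ℝ². -/
noncomputable def pd2 (f : ℝ × ℝ → ℝ) (x : ℝ × ℝ) : ℝ :=
  deriv (fun t => f (x.1, t)) x.2

/-- Gaussian curvature of the diagonal metric `ds² = g₁₁ dq₁² + g₂₂ dq₂²`:
`K = −(1/√(g₁₁g₂₂)) [ ∂₁((1/√g₁₁) ∂₁√g₂₂) + ∂₂((1/√g₂₂) ∂₂√g₁₁) ]`. -/
noncomputable def gaussK (g11 g22 : ℝ × ℝ → ℝ) (x : ℝ × ℝ) : ℝ :=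
  -(1 / Real.sqrt (g11 x * g22 x)) *
    (pd1 (fun y => 1 / Real.sqrt (g11 y) * pd1 (fun w => Real.sqrt (g22 w)) y) x
      + pd2 (fun y => 1 / Real.sqrt (g22 y) * pd2 (fun w => Real.sqrt (g11 w)) y) x)

/-- The one-variable factor of the metric coefficients. -/
def metricProfile (z t : ℝ) : ℝ := 2 * z * t ^ 2 / Real.sinh (z * t ^ 2)

lemma metricProfile_neg (z t : ℝ) : metricProfile (-z) t = metricProfile z t := by
  simp only [metricProfile, neg_mul, mul_neg, Real.sinh_neg, neg_div_neg_eq]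

lemma sinh_mul_sq_ne_zero {z t : ℝ} (hz : z ≠ 0) (ht : t ≠ 0) : Real.sinh (z * t ^ 2) ≠ 0 :=
  Real.sinh_ne_zero.2 (mul_ne_zero hz (pow_ne_zero 2 ht))

lemma metricProfile_pos {z t : ℝ} (hz : z ≠ 0) (ht : t ≠ 0) : 0 < metricProfile z t := by
  have ht2 : 0 < t ^ 2 := by positivity
  rcases hz.lt_or_gt with h | h
  · exact div_pos_of_neg_of_neg (by nlinarith) (Real.sinh_neg_iff.2 (by nlinarith))
  · exact div_pos (by positivity) (Real.sinh_pos_iff.2 (by positivity))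

lemma sqrt_exp_eq (u : ℝ) : √(Real.exp u) = Real.exp (u / 2) :=
  (Real.exp_half u).symm

lemma hasDerivAt_exp_half_sq (z t : ℝ) :
    HasDerivAt (fun s => Real.exp (z * s ^ 2 / 2)) (z * t * Real.exp (z * t ^ 2 / 2)) t := by
  have h := ((((hasDerivAt_id t).pow 2).const_mul z).div_const 2).exp
  refine h.congr_deriv ?_
  simp only [id, Pi.pow_apply]
  push_cast
  ring

lemma deriv_sqrt_mul_exp {c : ℝ} (hc : 0 ≤ c) (z t : ℝ) :
    deriv (fun s => √(c * Real.exp (z * s ^ 2))) t = √c * (z * t * Real.exp (z * t ^ 2 / 2)) := by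
  simp only [Real.sqrt_mul hc, sqrt_exp_eq]
  exact ((hasDerivAt_exp_half_sq z t).const_mul _).deriv

lemma hasDerivAt_metricProfile {z t : ℝ} (hz : z ≠ 0) (ht : t ≠ 0) :
    HasDerivAt (metricProfile z)
      (metricProfile z t *
        (2 / t - 2 * z * t * Real.cosh (z * t ^ 2) / Real.sinh (z * t ^ 2))) t := by
  have hs := sinh_mul_sq_ne_zero hz ht
  have hp : HasDerivAt (fun s : ℝ => s ^ 2) (2 * t) t := by simpa using hasDerivAt_pow 2 t
  refine ((hp.const_mul (2 * z)).div (hp.const_mul z).sinh hs).congr_deriv ?_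
  simp only [metricProfile]
  field_simp

lemma hasDerivAt_mul_exp_div_sqrt_metricProfile {z t : ℝ} (hz : z ≠ 0) (ht : t ≠ 0) :
    HasDerivAt (fun s => s * Real.exp (z * s ^ 2 / 2) / √(metricProfile z s))
      (√(metricProfile z t) / 2 * Real.exp (z * t ^ 2 / 2) * Real.exp (z * t ^ 2)) t := by
  have hs := sinh_mul_sq_ne_zero hz ht
  have hA := metricProfile_pos hz ht
  have hr : √(metricProfile z t) ≠ 0 := (Real.sqrt_pos.2 hA).ne'
  have hsq : √(metricProfile z t) ^ 2 = metricProfile z t := Real.sq_sqrt hA.le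
  have hd : metricProfile z t * Real.sinh (z * t ^ 2) = 2 * z * t ^ 2 := div_mul_cancel₀ _ hs
  refine (((hasDerivAt_id t).mul (hasDerivAt_exp_half_sq z t)).div
    ((hasDerivAt_metricProfile hz ht).sqrt hA.ne') hr).congr_deriv ?_
  rw [← Real.cosh_add_sinh (z * t ^ 2)]
  simp only [id, Pi.mul_apply]
  rw [← hsq] at hd
  generalize hR : √(metricProfile z t) = r at *
  rw [← hsq]
  field_simp
  linear_combination (-(Real.cosh (z * t ^ 2) + Real.sinh (z * t ^ 2))) * hd

lemma deriv_inv_sqrt_mul_deriv_sqrt {z a b c : ℝ} (hz : z ≠ 0) (ha : a ≠ 0) (hc : 0 ≤ c) :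
    deriv (fun t => 1 / √(metricProfile z t * Real.exp (-(z * b ^ 2))) *
        deriv (fun s => √(c * Real.exp (z * s ^ 2))) t) a =
      z / 2 * √c * √(metricProfile z a) * Real.exp (z * b ^ 2 / 2) *
        Real.exp (z * a ^ 2 / 2) * Real.exp (z * a ^ 2) := by
  have hfun : (fun t => 1 / √(metricProfile z t * Real.exp (-(z * b ^ 2))) *
        deriv (fun s => √(c * Real.exp (z * s ^ 2))) t) =
      fun t => (√c * z * Real.exp (z * b ^ 2 / 2)) *
        (t * Real.exp (z * t ^ 2 / 2) / √(metricProfile z t)) := by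
    funext t
    rw [deriv_sqrt_mul_exp hc, Real.sqrt_mul' _ (Real.exp_pos _).le, sqrt_exp_eq, neg_div,
      Real.exp_neg, one_div, mul_inv, inv_inv]
    ring
  rw [hfun, ((hasDerivAt_mul_exp_div_sqrt_metricProfile hz ha).const_mul _).deriv]
  ring

/-- the metric `g₁₁ = (2zq₁²/sinh(zq₁²)) e^{−zq₂²}`,
`g₂₂ = (2zq₂²/sinh(zq₂²)) e^{zq₁²}` has Gaussian curvature
`K = −z sinh(z(q₁² + q₂²))` wherever `q₁ ≠ 0` and `q₂ ≠ 0`. -/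
theorem curvature_integrable_case (z : ℝ) (hz : z ≠ 0)
    (x : ℝ × ℝ) (h1 : x.1 ≠ 0) (h2 : x.2 ≠ 0) :
    gaussK
      (fun y => 2 * z * y.1 ^ 2 / Real.sinh (z * y.1 ^ 2) * Real.exp (-(z * y.2 ^ 2)))
      (fun y => 2 * z * y.2 ^ 2 / Real.sinh (z * y.2 ^ 2) * Real.exp (z * y.1 ^ 2))
      x
      = -(z * Real.sinh (z * (x.1 ^ 2 + x.2 ^ 2))) := by
  obtain ⟨a, b⟩ := x
  have hA := metricProfile_pos hz h1
  have hB := metricProfile_pos hz h2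
  have e1 := deriv_inv_sqrt_mul_deriv_sqrt (b := b) hz h1 hB.le
  have e2 := deriv_inv_sqrt_mul_deriv_sqrt (b := a) (neg_ne_zero.2 hz) h2 hA.le
  simp only [metricProfile_neg, neg_mul, neg_neg] at e1 e2 hA hB
  simp only [gaussK, pd1, pd2, ← metricProfile.eq_1]
  rw [e1, e2, Real.sqrt_mul (mul_pos hA (Real.exp_pos _)).le, Real.sqrt_mul hA.le,
    Real.sqrt_mul hB.le, sqrt_exp_eq, sqrt_exp_eq, Real.sinh_eq]
  have hrA := (Real.sqrt_pos.2 hA).ne'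
  have hrB := (Real.sqrt_pos.2 hB).ne'
  have ea : Real.exp (z * a ^ 2) = Real.exp (z * a ^ 2 / 2) ^ 2 := by
    rw [← Real.exp_nat_mul]; congr 1; push_cast; ring
  have eb : Real.exp (z * b ^ 2) = Real.exp (z * b ^ 2 / 2) ^ 2 := by
    rw [← Real.exp_nat_mul]; congr 1; push_cast; ring
  simp only [mul_add, neg_add, Real.exp_add, neg_div, Real.exp_neg, ea, eb]
  have hEa := (Real.exp_pos (z * a ^ 2 / 2)).ne'
  have hEb := (Real.exp_pos (z * b ^ 2 / 2)).ne'
  field_simp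
  ring
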